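/- arXiv:2403.03753 — 3 statements merged into one kernel-verified Lean document; each statement's English description precedes it below -/
import Mathlib

section
/- The bilinear map C_μ : W(n)_μ × W(n)_μ → ℂ determined on basis elements by C_μ(e_α, e_β) = δ_{α,−β}·((μ·α)³ − μ·α)/12 is antisymmetric and satisfies the 2-cocycle identity C_μ(x, [y, z]) + C_μ(y, [z, x]) + C_μ(z, [x, y]) = 0 for all x, y, z ∈ W(n)_μ. -/
/-- The index lattice `ℤⁿ` (as functions `Fin n → ℤ`). -/
abbrev Zn (n : ℕ) := Fin n → ℤ

/-- Underlying vector space of the solenoidal Witt algebra `W(n)_μ`: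
finitely supported functions `ℤⁿ → ℂ`, with basis `e_α = single α 1`. -/
abbrev Wn (n : ℕ) := Zn n →₀ ℂ

/-- `μ·α = μ₁α₁ + ⋯ + μₙαₙ`. -/
noncomputable def mdot {n : ℕ} (μ : Fin n → ℂ) (α : Zn n) : ℂ :=
  ∑ i, μ i * (α i : ℂ)

/-- `μ` is generic: `μ·α ≠ 0` for every nonzero `α ∈ ℤⁿ`. -/
def Generic {n : ℕ} (μ : Fin n → ℂ) : Prop :=
  ∀ α : Zn n, α ≠ 0 → mdot μ α ≠ 0

/-- The basis vector `e_α` of `W(n)_μ`. -/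
noncomputable def ew {n : ℕ} (α : Zn n) : Wn n := Finsupp.single α 1

theorem mdot_add {n : ℕ} (μ : Fin n → ℂ) (α β : Zn n) :
    mdot μ (α + β) = mdot μ α + mdot μ β := by
  simp [mdot, mul_add, Finset.sum_add_distrib]

theorem mdot_neg {n : ℕ} (μ : Fin n → ℂ) (α : Zn n) : mdot μ (-α) = -mdot μ α := by
  simp [mdot]

theorem mdot_sub {n : ℕ} (μ : Fin n → ℂ) (α β : Zn n) :
    mdot μ (β - α) = mdot μ β - mdot μ α := by
  rw [sub_eq_add_neg, mdot_add, mdot_neg, sub_eq_add_neg]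

theorem single_eq_smul_ew {n : ℕ} (α : Zn n) (c : ℂ) :
    (Finsupp.single α c : Wn n) = c • ew α := by
  simp [ew]

/-- An additive predicate on `W(n)_μ` holds everywhere once it holds on multiples of the basis
vectors. -/
theorem Wn.induction_ew {n : ℕ} {p : Wn n → Prop} (x : Wn n) (zero : p 0)
    (add : ∀ x y, p x → p y → p (x + y)) (smul : ∀ (c : ℂ) α, p (c • ew α)) : p x := by
  induction x using Finsupp.induction_linear with
  | zero => exact zero
  | add x y hx hy => exact add x y hx hy
  | single α c => exact single_eq_smul_ew α c ▸ smul c α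

theorem cocycle_ew {n : ℕ} (μ : Fin n → ℂ)
    (B : Wn n →ₗ[ℂ] Wn n →ₗ[ℂ] Wn n)
    (hB : ∀ α β : Zn n, B (ew α) (ew β) = Finsupp.single (α + β) (mdot μ (β - α)))
    (C : Wn n →ₗ[ℂ] Wn n →ₗ[ℂ] ℂ)
    (hC : ∀ α β : Zn n, C (ew α) (ew β) =
      if α = -β then ((mdot μ α) ^ 3 - mdot μ α) / 12 else 0) (α β γ : Zn n) :
    C (ew α) (B (ew β) (ew γ)) + C (ew β) (B (ew γ) (ew α)) +
      C (ew γ) (B (ew α) (ew β)) = 0 := by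
  simp only [hB, single_eq_smul_ew, map_smul, hC, smul_eq_mul, eq_neg_iff_add_eq_zero]
  rw [show β + (γ + α) = α + (β + γ) by abel, show γ + (α + β) = α + (β + γ) by abel]
  split_ifs with h
  · obtain rfl := eq_neg_of_add_eq_zero_left h
    simp only [mdot_sub, mdot_neg, mdot_add]
    ring
  · simp

/-- The bilinear map `C_μ` determined on basis elements by
`C_μ(e_α, e_β) = δ_{α,−β}·((μ·α)³ − μ·α)/12` is antisymmetric and is a 2-cocycle
for the solenoidal Witt algebra bracket `[e_α, e_β] = μ·(β−α)·e_{α+β}`. -/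
theorem stmt1 (n : ℕ) (hn : 1 ≤ n) (μ : Fin n → ℂ) (hμ : Generic μ)
    (B : Wn n →ₗ[ℂ] Wn n →ₗ[ℂ] Wn n)
    (hB : ∀ α β : Zn n, B (ew α) (ew β) = Finsupp.single (α + β) (mdot μ (β - α)))
    (C : Wn n →ₗ[ℂ] Wn n →ₗ[ℂ] ℂ)
    (hC : ∀ α β : Zn n, C (ew α) (ew β) =
      if α = -β then ((mdot μ α) ^ 3 - mdot μ α) / 12 else 0) :
    (∀ x y : Wn n, C x y = - C y x) ∧
    (∀ x y z : Wn n, C x (B y z) + C y (B z x) + C z (B x y) = 0) := by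
  constructor
  · intro x y
    induction x using Wn.induction_ew with
    | zero => simp
    | add x x' hx hx' => simp only [map_add, LinearMap.add_apply, hx, hx']; ring
    | smul a α =>
      induction y using Wn.induction_ew with
      | zero => simp
      | add y y' hy hy' => simp only [map_add, LinearMap.add_apply, hy, hy']; ring
      | smul b β =>
        simp only [map_smul, LinearMap.smul_apply, hC, smul_eq_mul]
        by_cases h : α = -β
        · subst h
          simp only [neg_neg, if_true, mdot_neg]
          ring
        · have h' : β ≠ -α := fun e => h (by rw [e, neg_neg])
          simp [h, h']
  · intro x y z
    induction x using Wn.induction_ew with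
    | zero => simp
    | add x x' hx hx' =>
      simp only [map_add, LinearMap.add_apply]
      linear_combination hx + hx'
    | smul a α =>
      induction y using Wn.induction_ew with
      | zero => simp
      | add y y' hy hy' =>
        simp only [map_add, LinearMap.add_apply] at hy hy' ⊢
        linear_combination hy + hy'
      | smul b β =>
        induction z using Wn.induction_ew with
        | zero => simp
        | add z z' hz hz' =>
          simp only [map_add, LinearMap.add_apply] at hz hz' ⊢
          linear_combination hz + hz'
        | smul c γ =>
          simp only [map_smul, LinearMap.smul_apply, smul_eq_mul]
          linear_combination a * b * c * cocycle_ew μ B hB C hC α β γ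
end

section
/- In the W(n)_μ-module T_μ(0,0), the line ℂv_0 is a submodule on which W(n)_μ acts trivially, and the quotient module T̄_μ(0,0) := T_μ(0,0)/ℂv_0 is an irreducible W(n)_μ-module. -/
/-- Underlying space of the tensor-field modules `T_μ(a,b)`: the free `ℂ`-module
with basis `{v_β : β ∈ ℤⁿ}`. -/
abbrev Tn (n : ℕ) := Zn n →₀ ℂ

/-- The basis vector `v_β` of `T_μ(a,b)`. -/
noncomputable def vv {n : ℕ} (β : Zn n) : Tn n := Finsupp.single β 1

theorem mdot_injective {n : ℕ} {μ : Fin n → ℂ} (hμ : Generic μ) :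
    Function.Injective (mdot μ) := by
  intro α β h
  by_contra hne
  refine hμ (α - β) (sub_ne_zero.2 hne) ?_
  have hsub : mdot μ (α - β) = mdot μ α - mdot μ β := by
    simp [mdot, mul_sub]
  rw [hsub, h, sub_self]

theorem Finsupp.diagonal_apply {ι K : Type*} [CommRing K] (D : (ι →₀ K) →ₗ[K] ι →₀ K)
    (c : ι → K) (hD : ∀ i, D (single i 1) = c i • single i 1) (u : ι →₀ K) (i : ι) :
    D u i = c i * u i := by
  classical
  induction u using Finsupp.induction_linear with
  | zero => simp
  | add f g hf hg => simp [hf, hg, mul_add]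
  | single j a =>
    have h : single j a = a • single j (1 : K) := by simp
    rw [h, map_smul, hD]
    by_cases hij : j = i
    · subst hij; simp [mul_comm]
    · simp [hij]

/-- A subspace invariant under a diagonal operator with distinct eigenvalues contains every
basis vector occurring in one of its elements. -/
theorem Finsupp.single_mem_of_diagonal_invariant {ι K : Type*} [Field K]
    (D : (ι →₀ K) →ₗ[K] ι →₀ K) (c : ι → K) (hc : Function.Injective c)
    (hD : ∀ i, D (single i 1) = c i • single i 1) (U : Submodule K (ι →₀ K))
    (hU : ∀ u ∈ U, D u ∈ U) {u : ι →₀ K} (hu : u ∈ U) {i : ι} (hi : u i ≠ 0) :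
    single i 1 ∈ U := by
  classical
  have key : ∀ s : Finset ι, ∃ w ∈ U, ∀ j, w j = (∏ k ∈ s, (c j - c k)) * u j := by
    intro s
    induction s using Finset.induction_on with
    | empty => exact ⟨u, hu, by simp⟩
    | insert a s ha ih =>
      obtain ⟨w, hw, hwj⟩ := ih
      refine ⟨D w - c a • w, U.sub_mem (hU w hw) (U.smul_mem _ hw), fun j => ?_⟩
      rw [Finset.prod_insert ha, mul_assoc, ← hwj]
      simp [diagonal_apply D c hD, sub_mul]
  obtain ⟨w, hw, hwj⟩ := key (u.support.erase i)
  have hwi : w i ≠ 0 := by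
    rw [hwj]
    refine mul_ne_zero (Finset.prod_ne_zero_iff.2 fun k hk => ?_) hi
    exact sub_ne_zero.2 fun h => Finset.ne_of_mem_erase hk (hc h).symm
  have hws : w = w i • single i 1 := by
    ext j
    by_cases hij : j = i
    · subst hij; simp
    · have hzero : w j = 0 := by
        rw [hwj]
        by_cases hj : u j = 0
        · simp [hj]
        · rw [Finset.prod_eq_zero (i := j) (by simp [hij, hj]) (sub_self _), zero_mul]
      simp [hzero, Ne.symm hij]
  rw [hws] at hw
  exact (U.smul_mem_iff hwi).1 hw

/-- In the `W(n)_μ`-module `T_μ(0,0)` (action `e_α · v_β = (μ·β)·v_{α+β}`), the line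
`ℂv_0` is a submodule on which `W(n)_μ` acts trivially, and the quotient
`T̄_μ(0,0) = T_μ(0,0)/ℂv_0` is irreducible (equivalently, `ℂv_0 ≠ ⊤` and every
invariant submodule containing `ℂv_0` equals `ℂv_0` or `⊤`). -/
theorem stmt9 (n : ℕ) (hn : 1 ≤ n) (μ : Fin n → ℂ) (hμ : Generic μ)
    (ρ : Wn n →ₗ[ℂ] Tn n →ₗ[ℂ] Tn n)
    (hρ : ∀ α β : Zn n, ρ (ew α) (vv β) = (mdot μ β) • vv (α + β)) :
    (∀ (x : Wn n), ∀ w ∈ Submodule.span ℂ {vv (0 : Zn n)}, ρ x w = 0) ∧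
    Submodule.span ℂ {vv (0 : Zn n)} ≠ (⊤ : Submodule ℂ (Tn n)) ∧
    (∀ U : Submodule ℂ (Tn n), (∀ (x : Wn n), ∀ w ∈ U, ρ x w ∈ U) →
      Submodule.span ℂ {vv (0 : Zn n)} ≤ U →
      U = Submodule.span ℂ {vv (0 : Zn n)} ∨ U = ⊤) := by
  have h0 : mdot μ 0 = 0 := by simp [mdot]
  refine ⟨?_, ?_, ?_⟩
  · intro x w hw
    obtain ⟨a, rfl⟩ := Submodule.mem_span_singleton.1 hw
    rw [map_smul]
    suffices h : ρ x (vv 0) = 0 by rw [h, smul_zero]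
    induction x using Finsupp.induction_linear with
    | zero => simp
    | add f g hf hg => simp [hf, hg]
    | single α b =>
      have h : (Finsupp.single α b : Wn n) = b • ew α := by simp [ew]
      rw [h, map_smul, LinearMap.smul_apply, hρ, h0, zero_smul, smul_zero]
  · intro htop
    have hone : (fun _ => 1 : Zn n) ≠ 0 := fun h => one_ne_zero (congrFun h ⟨0, hn⟩)
    have hmem : vv (fun _ => 1 : Zn n) ∈ Submodule.span ℂ {vv (0 : Zn n)} := by
      rw [htop]; trivial
    obtain ⟨a, ha⟩ := Submodule.mem_span_singleton.1 hmem
    have h := DFunLike.congr_fun ha (fun _ => 1 : Zn n)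
    simp [vv, hone.symm] at h
  · intro U hU hle
    by_cases hsupp : ∃ u ∈ U, ∃ β : Zn n, β ≠ 0 ∧ u β ≠ 0
    · right
      obtain ⟨u, hu, β, hβ, huβ⟩ := hsupp
      have hvβ : vv β ∈ U :=
        Finsupp.single_mem_of_diagonal_invariant (ρ (ew 0)) (mdot μ) (mdot_injective hμ)
          (fun α => by simpa [vv] using hρ 0 α) U (hU (ew 0)) hu huβ
      have hv : ∀ γ : Zn n, vv γ ∈ U := by
        intro γ
        have h := hU (ew (γ - β)) _ hvβ
        rw [hρ, sub_add_cancel] at h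
        exact (U.smul_mem_iff (hμ β hβ)).1 h
      refine eq_top_iff.2 fun w _ => ?_
      induction w using Finsupp.induction_linear with
      | zero => exact U.zero_mem
      | add f g hf hg => exact U.add_mem (hf trivial) (hg trivial)
      | single γ a => simpa [vv] using U.smul_mem a (hv γ)
    · left
      push Not at hsupp
      refine le_antisymm (fun u hu => Submodule.mem_span_singleton.2 ⟨u 0, ?_⟩) hle
      ext β
      by_cases hβ : β = 0
      · subst hβ; simp [vv]
      · simp [vv, Ne.symm hβ, hsupp u hu β hβ]
end

section
/- For a, a′, b ∈ ℂ, the W(n)_μ-modules T_μ(a,b) and T_μ(a′,b) are isomorphic if and only if a − a′ ∈ Γ_μ; when a − a′ = μ·γ with γ ∈ ℤⁿ, an isomorphism is given by v_β ↦ v_{β+γ}. -/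
theorem mdot_zero {n : ℕ} (μ : Fin n → ℂ) : mdot μ 0 = 0 := by
  simp [mdot]

/-- `e_0` acts diagonally on `T_μ(a,b)`, with eigenvalue `a + μ·β` on `v_β`. -/
theorem ew_zero_action_apply {n : ℕ} {μ : Fin n → ℂ} {a b : ℂ}
    {ρ : Wn n →ₗ[ℂ] Tn n →ₗ[ℂ] Tn n}
    (hρ : ∀ α β : Zn n, ρ (ew α) (vv β) = (a + mdot μ β + b * mdot μ α) • vv (α + β))
    (w : Tn n) (β : Zn n) : ρ (ew 0) w β = (a + mdot μ β) * w β := by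
  have key : Finsupp.lapply β ∘ₗ ρ (ew 0) =
      (a + mdot μ β) • (Finsupp.lapply β : Tn n →ₗ[ℂ] ℂ) := by
    refine Finsupp.lhom_ext' fun δ => LinearMap.ext_ring ?_
    change ρ (ew 0) (vv δ) β = (a + mdot μ β) * (vv δ : Tn n) β
    rw [hρ, mdot_zero, mul_zero, add_zero, zero_add, Finsupp.smul_apply, smul_eq_mul]
    rcases eq_or_ne δ β with rfl | h
    · rfl
    · simp [vv, Finsupp.single_eq_of_ne' h]
  exact LinearMap.congr_fun key w

/-- The weight `a` of `v_0` must occur among the weights of `T_μ(a',b)`. -/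
theorem sub_mem_range_mdot_of_equiv {n : ℕ} {μ : Fin n → ℂ} {a a' b : ℂ}
    {ρ ρ' : Wn n →ₗ[ℂ] Tn n →ₗ[ℂ] Tn n}
    (hρ : ∀ α β : Zn n, ρ (ew α) (vv β) = (a + mdot μ β + b * mdot μ α) • vv (α + β))
    (hρ' : ∀ α β : Zn n, ρ' (ew α) (vv β) = (a' + mdot μ β + b * mdot μ α) • vv (α + β))
    (φ : Tn n ≃ₗ[ℂ] Tn n) (hφ : ∀ (x : Wn n) (w : Tn n), φ (ρ x w) = ρ' x (φ w)) :
    a - a' ∈ Set.range (mdot μ) := by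
  have hne : φ (vv 0) ≠ 0 := by simp [vv]
  obtain ⟨β, hβ⟩ := Finsupp.ne_iff.mp hne
  have h := DFunLike.congr_fun (hφ (ew 0) (vv 0)) β
  rw [ew_zero_action_apply hρ', hρ] at h
  simp only [mdot_zero, mul_zero, add_zero, map_smul, Finsupp.smul_apply, smul_eq_mul] at h
  have h' := mul_right_cancel₀ hβ h
  exact ⟨β, by rw [h']; ring⟩

/-- The translation `v_β ↦ v_{β+γ}` intertwines `T_μ(a,b)` and `T_μ(a',b)` when
`a - a' = μ·γ`. -/
theorem exists_translation_equiv {n : ℕ} {μ : Fin n → ℂ} {a a' b : ℂ}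
    {ρ ρ' : Wn n →ₗ[ℂ] Tn n →ₗ[ℂ] Tn n}
    (hρ : ∀ α β : Zn n, ρ (ew α) (vv β) = (a + mdot μ β + b * mdot μ α) • vv (α + β))
    (hρ' : ∀ α β : Zn n, ρ' (ew α) (vv β) = (a' + mdot μ β + b * mdot μ α) • vv (α + β))
    (γ : Zn n) (hγ : a - a' = mdot μ γ) :
    ∃ φ : Tn n ≃ₗ[ℂ] Tn n,
      (∀ (x : Wn n) (w : Tn n), φ (ρ x w) = ρ' x (φ w)) ∧
      (∀ β : Zn n, φ (vv β) = vv (β + γ)) := by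
  let φ : Tn n ≃ₗ[ℂ] Tn n := Finsupp.domLCongr (Equiv.addRight γ)
  have hv : ∀ β : Zn n, φ (vv β) = vv (β + γ) := fun β => by simp [φ, vv]
  have key : ρ.compr₂ φ.toLinearMap = ρ'.compl₂ φ.toLinearMap := by
    refine Finsupp.lhom_ext' fun α => LinearMap.ext_ring ?_
    refine Finsupp.lhom_ext' fun β => LinearMap.ext_ring ?_
    change φ (ρ (ew α) (vv β)) = ρ' (ew α) (φ (vv β))
    rw [hρ, map_smul, hv, hv, hρ', mdot_add, ← hγ, add_assoc α β γ]
    congr 1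
    ring
  exact ⟨φ, fun x w => LinearMap.congr_fun (LinearMap.congr_fun key x) w, hv⟩

/-- The `W(n)_μ`-modules `T_μ(a,b)` (action `ρ`) and `T_μ(a′,b)` (action `ρ'`) are
isomorphic if and only if `a − a′ ∈ Γ_μ`; moreover when `a − a′ = μ·γ` with `γ ∈ ℤⁿ`,
an isomorphism is given by `v_β ↦ v_{β+γ}`. -/
theorem stmt11 (n : ℕ) (hn : 1 ≤ n) (μ : Fin n → ℂ) (hμ : Generic μ) (a a' b : ℂ)
    (ρ ρ' : Wn n →ₗ[ℂ] Tn n →ₗ[ℂ] Tn n)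
    (hρ : ∀ α β : Zn n, ρ (ew α) (vv β) = (a + mdot μ β + b * mdot μ α) • vv (α + β))
    (hρ' : ∀ α β : Zn n, ρ' (ew α) (vv β) = (a' + mdot μ β + b * mdot μ α) • vv (α + β)) :
    ((∃ φ : Tn n ≃ₗ[ℂ] Tn n, ∀ (x : Wn n) (w : Tn n), φ (ρ x w) = ρ' x (φ w)) ↔
      a - a' ∈ Set.range (mdot μ)) ∧
    (∀ γ : Zn n, a - a' = mdot μ γ →
      ∃ φ : Tn n ≃ₗ[ℂ] Tn n,
        (∀ (x : Wn n) (w : Tn n), φ (ρ x w) = ρ' x (φ w)) ∧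
        (∀ β : Zn n, φ (vv β) = vv (β + γ))) := by
  refine ⟨⟨?_, ?_⟩, exists_translation_equiv hρ hρ'⟩
  · rintro ⟨φ, hφ⟩
    exact sub_mem_range_mdot_of_equiv hρ hρ' φ hφ
  · rintro ⟨γ, hγ⟩
    obtain ⟨φ, hφ, -⟩ := exists_translation_equiv hρ hρ' γ hγ.symm
    exact ⟨φ, hφ⟩
end
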